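/- Let A = ⟨α, β, {A_a}⟩ be a WFA over a finite alphabet Σ. (1) If A is a generative probabilistic automaton, i.e. f_A(x) ≥ 0 for all x and Σ_{x∈Σ*} f_A(x) = 1, then Σ_{x∈Σ*} f_A(x)² < ∞. (2) If A is a det-free proper dynamic probabilistic automaton, i.e. α ≥ 0 entry-wise with αᵀ1 = 1, β = 1 (the all-ones vector), each A_a has non-negative entries with Σ_{a∈Σ} A_a 1 = 1, and ‖A_a‖_∞ < 1 for every a ∈ Σ, then Σ_{x∈Σ*} f_A(x)² < ∞. -/

import Mathlib

open scoped ENNReal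
open scoped Kronecker
open Matrix

noncomputable section

/-- A weighted finite automaton of dimension `n` over alphabet `S`,
with initial weights, final weights and transition matrices. -/
structure WFA (S : Type*) (n : ℕ) where
  init : Fin n → ℝ
  final : Fin n → ℝ
  trans : S → Matrix (Fin n) (Fin n) ℝ

namespace WFA

variable {S : Type*} {n : ℕ}

/-- `A_x = A_{x₁} ⋯ A_{x_t}` (identity for the empty string). -/
def matOf (M : WFA S n) (x : List S) : Matrix (Fin n) (Fin n) ℝ :=
  (x.map M.trans).prod

/-- The function computed by the WFA: `f_A(x) = αᵀ A_x β`. -/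
def f (M : WFA S n) (x : List S) : ℝ :=
  M.init ⬝ᵥ (M.matOf x).mulVec M.final

/-- Row `p` of the forward matrix: `αᵀ A_p`. -/
def fwd (M : WFA S n) (x : List S) : Fin n → ℝ :=
  Matrix.vecMul M.init (M.matOf x)

/-- Row `s` of the backward matrix: `(A_s β)ᵀ`. -/
def bwd (M : WFA S n) (x : List S) : Fin n → ℝ :=
  (M.matOf x).mulVec M.final

/-- `M` is a minimal WFA: no WFA of strictly smaller dimension computes the same function. -/
def Min (M : WFA S n) : Prop :=
  ∀ m : ℕ, (∃ B : WFA S m, B.f = M.f) → n ≤ m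

/-- The reachability Gramian `G_p = Pᵀ P` is well-defined: all its defining sums converge. -/
def GpDefined (M : WFA S n) : Prop :=
  ∀ i j, Summable fun x : List S => M.fwd x i * M.fwd x j

/-- The observability Gramian `G_s = Sᵀ S` is well-defined: all its defining sums converge. -/
def GsDefined (M : WFA S n) : Prop :=
  ∀ i j, Summable fun x : List S => M.bwd x i * M.bwd x j

/-- The reachability Gramian `G_p = Pᵀ P`. -/
def Gp (M : WFA S n) : Matrix (Fin n) (Fin n) ℝ :=
  Matrix.of fun i j => ∑' x : List S, M.fwd x i * M.fwd x j

/-- The observability Gramian `G_s = Sᵀ S`. -/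
def Gs (M : WFA S n) : Matrix (Fin n) (Fin n) ℝ :=
  Matrix.of fun i j => ∑' x : List S, M.bwd x i * M.bwd x j

/-- Truncation of a WFA to its first `m` states. -/
def trunc (M : WFA S n) (m : ℕ) (h : m ≤ n) : WFA S m where
  init := fun i => M.init (Fin.castLE h i)
  final := fun i => M.final (Fin.castLE h i)
  trans := fun a => Matrix.of fun i j => M.trans a (Fin.castLE h i) (Fin.castLE h j)

end WFA

/-- A function `f : Σ* → ℝ` is rational if it is computed by some WFA. -/
def IsRational {S : Type*} (f : List S → ℝ) : Prop :=
  ∃ (n : ℕ) (M : WFA S n), M.f = f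

/-- Spectral radius of a real square matrix: the largest modulus of its complex eigenvalues. -/
def specRad {d : Type*} [Fintype d] [DecidableEq d] (M : Matrix d d ℝ) : ℝ≥0∞ :=
  spectralRadius ℂ (M.map (algebraMap ℝ ℂ))

/-- Induced ∞-norm of a matrix: maximum absolute row sum. -/
def normInfM {d e : Type*} [Fintype d] [Fintype e] (M : Matrix d e ℝ) : ℝ :=
  ⨆ i, ∑ j, |M i j|

/-- Induced 1-norm of a matrix: maximum absolute column sum. -/
def normOneM {d e : Type*} [Fintype d] [Fintype e] (M : Matrix d e ℝ) : ℝ :=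
  ⨆ j, ∑ i, |M i j|

/-- The `p`-norm of a finite-dimensional real vector, `1 ≤ p ≤ ∞`. -/
def vecPNorm {d : Type*} [Fintype d] (p : ℝ≥0∞) (v : d → ℝ) : ℝ :=
  if p = ⊤ then ⨆ i, |v i| else (∑ i, |v i| ^ p.toReal) ^ (1 / p.toReal)

/-- The induced matrix `p`-norm `‖M‖_p = sup_{‖v‖_p = 1} ‖Mv‖_p`. -/
def inducedPNorm {d : Type*} [Fintype d] (p : ℝ≥0∞) (M : Matrix d d ℝ) : ℝ :=
  sSup {r | ∃ v : d → ℝ, vecPNorm p v = 1 ∧ r = vecPNorm p (M.mulVec v)}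

/-- The operator norm of the Hankel operator of `f` on `ℓ²`. -/
def hankelOpNorm {S : Type*} (f : List S → ℝ) : ℝ :=
  sSup {r | ∃ g : List S → ℝ, (Summable fun y => g y ^ 2) ∧ (∑' y, g y ^ 2) ≤ 1 ∧
    (Summable fun x : List S => (∑' y : List S, f (x ++ y) * g y) ^ 2) ∧
    r = Real.sqrt (∑' x : List S, (∑' y : List S, f (x ++ y) * g y) ^ 2)}

end

namespace WFA

theorem bwd_cons {S : Type*} {n : ℕ} (M : WFA S n) (a : S) (x : List S) (i : Fin n) :
    M.bwd (a :: x) i = ∑ j, M.trans a i j * M.bwd x j := by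
  simp only [bwd, matOf, List.map_cons, List.prod_cons, ← Matrix.mulVec_mulVec]
  rfl

theorem f_eq_sum_init_mul_bwd {S : Type*} {n : ℕ} (M : WFA S n) (x : List S) :
    M.f x = ∑ i, M.init i * M.bwd x i := rfl

theorem bwd_nonneg {S : Type*} {n : ℕ} {M : WFA S n} (hfinal : ∀ i, 0 ≤ M.final i)
    (htrans : ∀ (a : S) i j, 0 ≤ M.trans a i j) (x : List S) (i : Fin n) :
    0 ≤ M.bwd x i := by
  induction x generalizing i with
  | nil => simpa [bwd, matOf] using hfinal i
  | cons a x ih =>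
    rw [bwd_cons]
    exact Finset.sum_nonneg fun j _ => mul_nonneg (htrans a i j) (ih j)

theorem bwd_le_pow {S : Type*} {n : ℕ} {M : WFA S n} {r : ℝ} (hr : 0 ≤ r)
    (hfinal : ∀ i, M.final i ≤ 1) (htrans : ∀ (a : S) i j, 0 ≤ M.trans a i j)
    (hrow : ∀ (a : S) i, ∑ j, M.trans a i j ≤ r) (x : List S) (i : Fin n) :
    M.bwd x i ≤ r ^ x.length := by
  induction x generalizing i with
  | nil => simpa [bwd, matOf] using hfinal i
  | cons a x ih =>
    rw [bwd_cons, List.length_cons, pow_succ']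
    calc ∑ j, M.trans a i j * M.bwd x j
        ≤ ∑ j, M.trans a i j * r ^ x.length :=
          Finset.sum_le_sum fun j _ => mul_le_mul_of_nonneg_left (ih j) (htrans a i j)
      _ = (∑ j, M.trans a i j) * r ^ x.length := by rw [Finset.sum_mul]
      _ ≤ r * r ^ x.length := mul_le_mul_of_nonneg_right (hrow a i) (pow_nonneg hr _)

theorem sum_bwd_ofFn {S : Type*} [Fintype S] {n : ℕ} {M : WFA S n}
    (hfinal : ∀ i, M.final i = 1) (hrow : ∀ i, ∑ a : S, ∑ j, M.trans a i j = 1)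
    (k : ℕ) (i : Fin n) : ∑ t : Fin k → S, M.bwd (List.ofFn t) i = 1 := by
  induction k generalizing i with
  | zero => simpa [bwd, matOf] using hfinal i
  | succ k ih =>
    rw [← (Fin.consEquiv fun _ : Fin (k + 1) => S).sum_comp, Fintype.sum_prod_type, ← hrow i]
    refine Finset.sum_congr rfl fun a _ => ?_
    simp only [Fin.consEquiv, Equiv.coe_fn_mk, List.ofFn_succ, Fin.cons_zero, Fin.cons_succ,
      bwd_cons]
    rw [Finset.sum_comm]
    exact Finset.sum_congr rfl fun j _ => by rw [← Finset.mul_sum, ih j, mul_one]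

theorem sum_f_ofFn {S : Type*} [Fintype S] {n : ℕ} {M : WFA S n}
    (hinit : ∑ i, M.init i = 1) (hfinal : ∀ i, M.final i = 1)
    (hrow : ∀ i, ∑ a : S, ∑ j, M.trans a i j = 1) (k : ℕ) :
    ∑ t : Fin k → S, M.f (List.ofFn t) = 1 := by
  simp only [f_eq_sum_init_mul_bwd]
  rw [Finset.sum_comm, ← hinit]
  exact Finset.sum_congr rfl fun i _ => by
    rw [← Finset.mul_sum, sum_bwd_ofFn hfinal hrow, mul_one]

end WFA

theorem sum_abs_le_normInfM {d e : Type*} [Fintype d] [Fintype e] (M : Matrix d e ℝ) (i : d) :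
    ∑ j, |M i j| ≤ normInfM M :=
  le_ciSup (f := fun i => ∑ j, |M i j|) (Set.finite_range _).bddAbove i

theorem exists_nonneg_lt_one_forall_le {ι : Type*} [Finite ι] {g : ι → ℝ}
    (hg : ∀ i, g i < 1) : ∃ r, 0 ≤ r ∧ r < 1 ∧ ∀ i, g i ≤ r := by
  cases isEmpty_or_nonempty ι
  · exact ⟨0, le_rfl, one_pos, isEmptyElim⟩
  · obtain ⟨i, hi⟩ := Finite.exists_max g
    exact ⟨max 0 (g i), le_max_left _ _, max_lt one_pos (hg i),
      fun j => (hi j).trans (le_max_right _ _)⟩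

theorem summable_list_of_sum_ofFn_le {S : Type*} [Fintype S] {g : List S → ℝ} {u : ℕ → ℝ}
    (hg : ∀ x, 0 ≤ g x) (hu : Summable u)
    (hgu : ∀ k, ∑ t : Fin k → S, g (List.ofFn t) ≤ u k) : Summable g := by
  refine List.equivSigmaTuple.symm.summable_iff.mp ((summable_sigma_of_nonneg fun _ => hg _).mpr ?_)
  refine ⟨fun k => (hasSum_fintype _).summable, ?_⟩
  refine Summable.of_nonneg_of_le (fun k => tsum_nonneg fun _ => hg _) (fun k => ?_) hu
  rw [tsum_fintype]
  exact hgu k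

/-- (1) every generative probabilistic automaton computes a function in `ℓ²`;
(2) every det-free proper dynamic probabilistic automaton computes a function in `ℓ²`. -/
theorem probabilistic_automata_ell_two {S : Type*} [Fintype S] {n : ℕ} (M : WFA S n) :
    ((∀ x : List S, 0 ≤ M.f x) → HasSum M.f 1 →
      Summable fun x : List S => M.f x ^ 2) ∧
    (((∀ i, 0 ≤ M.init i) ∧ (∑ i, M.init i) = 1 ∧ (∀ i, M.final i = 1) ∧
      (∀ (a : S) i j, 0 ≤ M.trans a i j) ∧ (∀ i, (∑ a : S, ∑ j, M.trans a i j) = 1) ∧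
      (∀ a : S, normInfM (M.trans a) < 1)) →
      Summable fun x : List S => M.f x ^ 2) := by
  constructor
  · intro hnonneg hsum
    refine Summable.of_nonneg_of_le (fun x => sq_nonneg _) (fun x => ?_) hsum.summable
    exact pow_le_of_le_one (hnonneg x) (le_hasSum hsum x fun y _ => hnonneg y) two_ne_zero
  · rintro ⟨hinit, hinit_sum, hfinal, htrans, hrow, hnorm⟩
    obtain ⟨r, hr, hr_lt, hnorm_le⟩ := exists_nonneg_lt_one_forall_le hnorm
    have hrow_le (a : S) (i : Fin n) : ∑ j, M.trans a i j ≤ r :=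
      (Finset.sum_le_sum fun j _ => le_abs_self _).trans
        ((sum_abs_le_normInfM _ i).trans (hnorm_le a))
    have hf_nonneg (x : List S) : 0 ≤ M.f x := by
      rw [WFA.f_eq_sum_init_mul_bwd]
      exact Finset.sum_nonneg fun i _ => mul_nonneg (hinit i)
        (WFA.bwd_nonneg (fun i => (hfinal i).symm ▸ zero_le_one) htrans x i)
    have hf_le (x : List S) : M.f x ≤ r ^ x.length := by
      rw [WFA.f_eq_sum_init_mul_bwd, ← one_mul (r ^ _), ← hinit_sum, Finset.sum_mul]
      exact Finset.sum_le_sum fun i _ => mul_le_mul_of_nonneg_left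
        (WFA.bwd_le_pow hr (fun i => (hfinal i).le) htrans hrow_le x i) (hinit i)
    refine summable_list_of_sum_ofFn_le (fun x => sq_nonneg _)
      (summable_geometric_of_lt_one hr hr_lt) fun k => ?_
    calc ∑ t : Fin k → S, M.f (List.ofFn t) ^ 2
        ≤ ∑ t : Fin k → S, r ^ k * M.f (List.ofFn t) := Finset.sum_le_sum fun t _ => by
          rw [sq]
          exact mul_le_mul_of_nonneg_right (by simpa using hf_le (List.ofFn t)) (hf_nonneg _)
      _ = r ^ k := by
          rw [← Finset.mul_sum, WFA.sum_f_ofFn hinit_sum hfinal hrow, mul_one]
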